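/- arXiv:1509.01371 — 4 statements merged into one kernel-verified Lean document; each statement's English description precedes it below -/
import Mathlib

section
/- Let m be even. For every a ∈ F_r^* with Tr(a^{-1}) = 0 and every ρ ∈ F_p^*, the number N_a(ρ) of x ∈ F_r^* with Tr(x) = 0 and Tr(ax²) = ρ equals p^{m-2} + (-1)^{((p-1)/2)·(m/2)} · η(a) · p^{(m-2)/2}. -/
open Finset

section GaussSum

variable {F : Type*} [Field F] [Fintype F] [DecidableEq F]

/-- The quadratic character of a finite field with complex values. -/
noncomputable def complexQuadraticChar (F : Type*) [Field F] [Fintype F] [DecidableEq F] :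
    MulChar F ℂ :=
  (quadraticChar F).ringHomComp (Int.castRingHom ℂ)

lemma complexQuadraticChar_apply (x : F) :
    complexQuadraticChar F x = (quadraticChar F x : ℂ) := rfl

lemma complexQuadraticChar_ne_one (hF : ringChar F ≠ 2) : complexQuadraticChar F ≠ 1 :=
  (MulChar.ringHomComp_ne_one_iff (Int.castRingHom ℂ).injective_int).mpr (quadraticChar_ne_one hF)

lemma complexQuadraticChar_isQuadratic : (complexQuadraticChar F).IsQuadratic :=
  (quadraticChar_isQuadratic F).comp _

/-- On a field with `q ^ 2` elements, `q` odd, the quadratic character of an eigenvector of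
`x ↦ x ^ q` with eigenvalue `ε = ± 1` is `ε ^ ((q + 1) / 2)`. -/
lemma quadraticChar_of_pow_eq {q : ℕ} (hF : ringChar F ≠ 2) (hq : Odd q)
    (hcard : Fintype.card F = q ^ 2) {ε : ℤ} (hε : ε = 1 ∨ ε = -1) {x : F} (hx : x ≠ 0)
    (hxq : x ^ q = ε * x) : quadraticChar F x = ε ^ ((q + 1) / 2) := by
  obtain ⟨k, rfl⟩ := hq
  have hx' : x ^ (2 * k) = ε := by
    apply mul_right_cancel₀ hx
    rw [← hxq, pow_succ]
  have h2 : (2 * k + 1) ^ 2 / 2 = 2 * k * (k + 1) := by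
    have : (2 * k + 1) ^ 2 = 2 * (2 * k * (k + 1)) + 1 := by ring
    omega
  have h3 : (2 * k + 1 + 1) / 2 = k + 1 := by omega
  have key : ((quadraticChar F x : ℤ) : F) = ((ε ^ (k + 1) : ℤ) : F) := by
    rw [quadraticChar_eq_pow_of_char_ne_two' hF, hcard, h2, pow_mul, hx']
    push_cast
    rfl
  rw [h3]
  have hne : (-1 : F) ≠ 1 := Ring.neg_one_ne_one_of_char_ne_two hF
  have he : ε ^ (k + 1) = 1 ∨ ε ^ (k + 1) = -1 := by
    rcases hε with rfl | rfl
    · simp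
    · exact neg_one_pow_eq_or ℤ _
  rcases quadraticChar_dichotomy hx with h | h <;> rcases he with h' | h' <;>
    rw [h, h'] at key ⊢ <;> push_cast at key
  · exact absurd key.symm hne
  · exact absurd key hne

/-- A quadratic Gauss sum over a field with `q ^ 2` elements, for an additive character
invariant under `x ↦ x ^ q`. -/
theorem gaussSum_complexQuadraticChar_of_card_eq_sq {p n : ℕ} [Fact p.Prime] [CharP F p]
    (hp : p ≠ 2) (hcard : Fintype.card F = (p ^ n) ^ 2) {ψ : AddChar F ℂ} (hψ : ψ.IsPrimitive)
    (hfrob : ∀ x, ψ (x ^ p ^ n) = ψ x) :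
    gaussSum (complexQuadraticChar F) ψ = (-1) ^ ((p ^ n + 1) / 2) * p ^ n := by
  have hF : ringChar F ≠ 2 := by rwa [ringChar.eq F p]
  have hadd (x y : F) : (x + y) ^ p ^ n = x ^ p ^ n + y ^ p ^ n := add_pow_char_pow x y p n
  have hodd : Odd (p ^ n) := ((Fact.out : p.Prime).odd_of_ne_two hp).pow
  have hqc : (((p ^ n : ℕ) : ℤ) : ℂ) = (p : ℂ) ^ n := by push_cast; rfl
  rw [← hqc]
  generalize p ^ n = q at *
  have hinv (x : F) : (x ^ q) ^ q = x := by
    rw [← pow_mul, ← sq, ← hcard, FiniteField.pow_card]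
  have hq1 : 1 < q := by
    have := Fintype.one_lt_card (α := F)
    rw [hcard] at this
    by_contra! h
    nlinarith
  set χ := complexQuadraticChar F with hχ
  set G := gaussSum χ ψ with hG
  set L : Finset F := univ.filter fun x => x ^ q = -x with hL
  set c : ℤ := (-1) ^ ((q + 1) / 2) with hc
  have hcc : c = 1 ∨ c = -1 := neg_one_pow_eq_or ℤ _
  have hχL : ∀ x ∈ L, x ≠ 0 → χ x = (c : ℂ) := fun x hx hx0 => by
    rw [hχ, complexQuadraticChar_apply,
      quadraticChar_of_pow_eq hF hodd hcard (Or.inr rfl) hx0 (by simpa [hL] using hx)]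
  have hχK (x : F) (hx : x ^ q = x) (hx0 : x ≠ 0) : χ x = 1 := by
    rw [hχ, complexQuadraticChar_apply,
      quadraticChar_of_pow_eq hF hodd hcard (Or.inl rfl) hx0 (by simpa using hx)]
    simp
  have h0L : (0 : F) ∈ L := by simp [hL, (show q ≠ 0 by omega)]
  have hsum1 : ∑ x, χ x * ∑ y, ψ ((y + y ^ q) * x) = (q : ℂ) ^ 2 * ((L.card - 1 : ℤ) * c) := by
    have hin (x : F) : ∑ y, ψ ((y + y ^ q) * x) = if x ∈ L then (q : ℂ) ^ 2 else 0 := by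
      have h1 (y : F) : ψ (y ^ q * x) = ψ (y * x ^ q) := by
        rw [← hfrob, mul_pow, hinv]
      have : ∀ y, ψ ((y + y ^ q) * x) = ψ (y * (x + x ^ q)) := fun y => by
        rw [add_mul, mul_add, AddChar.map_add_eq_mul, AddChar.map_add_eq_mul, h1]
      simp_rw [this]
      rw [AddChar.sum_mulShift _ hψ, hcard]
      simp only [hL, mem_filter_univ, eq_neg_iff_add_eq_zero, add_comm]
      split_ifs <;> simp
    simp_rw [hin, mul_ite, mul_zero]
    rw [← sum_filter, filter_mem_eq_inter, univ_inter, ← sum_mul, mul_comm]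
    congr 1
    rw [← sum_erase_add _ _ h0L, MulChar.map_zero, add_zero,
      sum_congr rfl (fun x hx => hχL x (mem_of_mem_erase hx) (ne_of_mem_erase hx)), sum_const,
      card_erase_of_mem h0L, nsmul_eq_mul, Nat.cast_sub (card_pos.mpr ⟨_, h0L⟩)]
    push_cast
    rfl
  have hsum2 : ∑ x, χ x * ∑ y, ψ ((y + y ^ q) * x) = ((q : ℂ) ^ 2 - L.card) * G := by
    simp_rw [mul_sum]
    rw [sum_comm]
    have hin (y : F) : ∑ x, χ x * ψ ((y + y ^ q) * x) = if y ∈ L then 0 else G := by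
      have hy : y ∈ L ↔ y + y ^ q = 0 := by
        simp only [hL, mem_filter_univ, eq_neg_iff_add_eq_zero, add_comm]
      split_ifs with h
      · simp [hy.mp h, MulChar.sum_eq_zero_of_ne_one (complexQuadraticChar_ne_one hF), hχ]
      · have h0 : y + y ^ q ≠ 0 := mt hy.mpr h
        have := gaussSum_mulShift χ ψ (Units.mk0 _ h0)
        rw [Units.val_mk0, hχK _ (by rw [hadd, hinv, add_comm]) h0, one_mul] at this
        rw [hG, ← this]
        rfl
    simp_rw [hin]
    rw [sum_ite, sum_const_zero, zero_add, sum_const, nsmul_eq_mul, filter_notMem_eq_sdiff,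
      card_sdiff_of_subset (subset_univ _), card_univ, Nat.cast_sub (card_le_univ _), hcard]
    push_cast
    rfl
  have hGsq : G ^ 2 = (q : ℂ) ^ 2 := by
    rw [hG, gaussSum_sq (complexQuadraticChar_ne_one hF) complexQuadraticChar_isQuadratic hψ,
      ← hχ, hχK _ hodd.neg_one_pow (neg_ne_zero.mpr one_ne_zero), hcard]
    push_cast
    ring
  obtain ⟨s, hs, hGs⟩ : ∃ s : ℤ, (s = 1 ∨ s = -1) ∧ G = (s * q : ℤ) := by
    rcases sq_eq_sq_iff_eq_or_eq_neg.mp hGsq with h | h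
    · exact ⟨1, .inl rfl, by simp [h]⟩
    · exact ⟨-1, .inr rfl, by simp [h]⟩
  have key : ((q : ℤ) ^ 2 - L.card) * (s * q) = (q : ℤ) ^ 2 * ((L.card - 1) * c) := by
    have := hsum2.symm.trans hsum1
    rw [hGs] at this
    exact_mod_cast this
  have hl1 : (1 : ℤ) ≤ L.card := by exact_mod_cast card_pos.mpr ⟨_, h0L⟩
  have hl2 : (L.card : ℤ) ≤ (q : ℤ) ^ 2 := by
    exact_mod_cast hcard ▸ card_le_univ L
  have hq1' : (1 : ℤ) < q := by exact_mod_cast hq1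
  have hsc : s = c := by
    by_contra hne
    have hsc : s = -c := by
      omega
    have hc0 : c * q ≠ 0 := mul_ne_zero (by rcases hcc with h | h <;> simp [h]) (by omega)
    have : (q : ℤ) ^ 2 - L.card + q * (L.card - 1) = 0 := by
      apply (mul_eq_zero.mp (_ : (c * q) * _ = 0)).resolve_left hc0
      rw [hsc] at key
      linear_combination -key
    nlinarith
  rw [hGs, hsc]
  simp [hc]

/-- The quadratic exponential sum `∑ x, ψ (b * x ^ 2)` in terms of the Gauss sum. -/
theorem sum_addChar_mul_sq (hF : ringChar F ≠ 2) {ψ : AddChar F ℂ} (hψ : ψ.IsPrimitive) {b : F}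
    (hb : b ≠ 0) :
    ∑ x, ψ (b * x ^ 2) = complexQuadraticChar F b * gaussSum (complexQuadraticChar F) ψ := by
  have h1 : ∑ x, ψ (b * x ^ 2) = ∑ t, (1 + complexQuadraticChar F t) * ψ (b * t) := by
    rw [← sum_fiberwise (s := univ) (g := fun x : F => x ^ 2)]
    refine sum_congr rfl fun t _ => ?_
    rw [sum_congr rfl (g := fun _ => ψ (b * t)) (fun x hx => by simp_all), sum_const,
      nsmul_eq_mul]
    congr 1
    have := quadraticChar_card_sqrts hF t
    rw [Set.toFinset_ofPred] at this
    rw [complexQuadraticChar_apply, add_comm]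
    exact_mod_cast this
  have h2 : ∑ t, ψ (b * t) = 0 := AddChar.sum_eq_zero_of_ne_one (hψ hb)
  have h3 := gaussSum_mulShift (complexQuadraticChar F) ψ (Units.mk0 b hb)
  rw [Units.val_mk0] at h3
  have h4 : complexQuadraticChar F b * complexQuadraticChar F b = 1 := by
    rw [complexQuadraticChar_apply]
    exact_mod_cast (sq (quadraticChar F b)) ▸ quadraticChar_sq_one hb
  rw [h1, ← h3, ← mul_assoc, h4, one_mul]
  simp_rw [add_mul, one_mul]
  rw [sum_add_distrib, h2, zero_add]
  rfl

/-- The exponential sum of a quadratic polynomial, by completing the square. -/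
theorem sum_addChar_quadratic (hF : ringChar F ≠ 2) {ψ : AddChar F ℂ} (hψ : ψ.IsPrimitive) {b : F}
    (hb : b ≠ 0) (c : F) :
    ∑ x, ψ (b * x ^ 2 + c * x) = ψ (-(c ^ 2 / (4 * b))) *
      (complexQuadraticChar F b * gaussSum (complexQuadraticChar F) ψ) := by
  have h2 : (2 : F) ≠ 0 := Ring.two_ne_zero hF
  rw [← sum_addChar_mul_sq hF hψ hb, mul_sum,
    ← Equiv.sum_comp (Equiv.addRight (c / (2 * b))) (fun x => _ * ψ (b * x ^ 2))]
  refine sum_congr rfl fun x _ => ?_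
  rw [← AddChar.map_add_eq_mul, Equiv.coe_addRight]
  congr 1
  rw [show (4 : F) = 2 ^ 2 by norm_num]
  field_simp
  ring

end GaussSum

section Trace

variable (p : ℕ) [Fact p.Prime] (F : Type*) [Field F] [Algebra (ZMod p) F]

/-- The canonical additive character of a finite field of characteristic `p`. -/
noncomputable def traceAddChar : AddChar F ℂ :=
  ZMod.stdAddChar.compAddMonoidHom (Algebra.trace (ZMod p) F).toAddMonoidHom

variable {F}

lemma traceAddChar_apply (x : F) :
    traceAddChar p F x = ZMod.stdAddChar (Algebra.trace (ZMod p) F x) := rfl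

lemma traceAddChar_algebraMap_mul (y : ZMod p) (x : F) :
    traceAddChar p F (algebraMap (ZMod p) F y * x) =
      ZMod.stdAddChar (y * Algebra.trace (ZMod p) F x) := by
  rw [traceAddChar_apply, ← Algebra.smul_def, map_smul, smul_eq_mul]

lemma traceAddChar_isPrimitive [Finite F] : (traceAddChar p F).IsPrimitive := by
  apply AddChar.IsPrimitive.of_ne_one
  obtain ⟨x, hx⟩ := Algebra.trace_surjective (ZMod p) F 1
  refine AddChar.ne_one_iff.mpr ⟨x, ?_⟩
  rw [traceAddChar_apply, hx]
  exact (AddChar.zmod_char_ne_one_iff p _).mp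
    (by simpa using ZMod.isPrimitive_stdAddChar p one_ne_zero)

lemma trace_pow_char_pow [Finite F] (n : ℕ) (x : F) :
    Algebra.trace (ZMod p) F (x ^ p ^ n) = Algebra.trace (ZMod p) F x := by
  induction n with
  | zero => simp
  | succ n ih =>
    rw [pow_succ, pow_mul, ← ih]
    simpa [ZMod.card] using Algebra.trace_eq_of_algEquiv
      (FiniteField.frobeniusAlgEquivOfAlgebraic (ZMod p) F) (x ^ p ^ n)

end Trace

lemma neg_one_pow_half_pow_add_one {p : ℕ} (hp : Odd p) (n : ℕ) :
    (-1 : ℂ) ^ ((p ^ n + 1) / 2) = -(-1) ^ ((p - 1) / 2 * n) := by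
  obtain ⟨k, rfl⟩ := hp
  obtain ⟨j, hj⟩ : ∃ j, (2 * k + 1) ^ n = 2 * (k * n + 2 * j) + 1 := by
    induction n with
    | zero => exact ⟨0, by simp⟩
    | succ n ih =>
      obtain ⟨j, hj⟩ := ih
      exact ⟨j * (2 * k + 1) + k * k * n, by rw [pow_succ, hj]; ring⟩
  rw [hj, show (2 * (k * n + 2 * j) + 1 + 1) / 2 = k * n + 2 * j + 1 by omega,
    show (2 * k + 1 - 1) / 2 = k by omega, pow_succ, pow_add, pow_mul _ 2 j]
  simp

theorem stmt_0 (p m : ℕ) [Fact p.Prime] (hp2 : p ≠ 2) (hm : 2 ≤ m) (hmeven : Even m)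
    (F : Type) [Field F] [Fintype F] [DecidableEq F] [Algebra (ZMod p) F]
    (hcard : Fintype.card F = p ^ m)
    (a : F) (ha : a ≠ 0) (hTra : Algebra.trace (ZMod p) F a⁻¹ = 0)
    (ρ : ZMod p) (hρ : ρ ≠ 0) :
    (({x : F | x ≠ 0 ∧ Algebra.trace (ZMod p) F x = 0 ∧
        Algebra.trace (ZMod p) F (a * x ^ 2) = ρ}).ncard : ℤ)
      = (p : ℤ) ^ (m - 2)
        + (-1) ^ (((p - 1) / 2) * (m / 2)) * quadraticChar F a * (p : ℤ) ^ ((m - 2) / 2) := by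
  obtain ⟨n, rfl⟩ : ∃ n, m = 2 * (n + 1) := by
    obtain ⟨k, rfl⟩ := hmeven
    exact ⟨k - 1, by omega⟩
  have hp := (Fact.out : p.Prime).odd_of_ne_two hp2
  have : CharP F p := charP_of_injective_algebraMap (algebraMap (ZMod p) F).injective p
  have hF : ringChar F ≠ 2 := by rwa [ringChar.eq F p]
  have hcard' : Fintype.card F = (p ^ (n + 1)) ^ 2 := by rw [hcard, ← pow_mul, mul_comm]
  set ψ := traceAddChar p F with hψ
  have hprim : ψ.IsPrimitive := traceAddChar_isPrimitive p
  have hG := gaussSum_complexQuadraticChar_of_card_eq_sq (n := n + 1) hp2 hcard' hprim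
    fun x => by rw [hψ, traceAddChar_apply, trace_pow_char_pow, traceAddChar_apply]
  rw [neg_one_pow_half_pow_add_one hp] at hG
  set G := gaussSum (complexQuadraticChar F) ψ
  set D : ℂ := quadraticChar F a * G with hD
  let e : AddChar (ZMod p) ℂ := ZMod.stdAddChar
  have he : e.IsPrimitive := ZMod.isPrimitive_stdAddChar p
  let T := Algebra.trace (ZMod p) F
  let ι := algebraMap (ZMod p) F
  have hin (y z : ZMod p) : ∑ x : F, ψ (ι y * (a * x ^ 2) + ι z * x) =
      if y = 0 then (if z = 0 then (p : ℂ) ^ (2 * (n + 1)) else 0) else D := by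
    split_ifs with hy hz
    · simp [hy, hz, hcard]
    · simpa [hy] using AddChar.sum_eq_zero_of_ne_one
        (hprim ((map_ne_zero (algebraMap (ZMod p) F)).mpr hz))
    · have hy' : ι y ≠ 0 := (map_ne_zero ι).mpr hy
      have h1 := sum_addChar_quadratic hF hprim (mul_ne_zero hy' ha) (ι z)
      have h2 : -(ι z ^ 2 / (4 * (ι y * a))) = ι (-(z ^ 2 / (4 * y))) * a⁻¹ := by
        simp only [ι, map_neg, map_div₀, map_pow, map_mul, map_ofNat]
        rw [← mul_assoc, div_mul_eq_div_div, div_eq_mul_inv _ a, neg_mul]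
      have h3 : quadraticChar F (ι y) = 1 := by
        rw [quadraticChar_of_pow_eq hF hp.pow hcard' (Or.inl rfl) hy', one_pow]
        rw [← map_pow, ZMod.pow_card_pow, Int.cast_one, one_mul]
      rw [h2, hψ, traceAddChar_algebraMap_mul, hTra, mul_zero, AddChar.map_zero_eq_one, one_mul,
        complexQuadraticChar_apply, map_mul, h3, one_mul] at h1
      rw [hD, ← h1]
      simp only [mul_assoc]
      rfl
  set N := ({x : F | x ≠ 0 ∧ T x = 0 ∧ T (a * x ^ 2) = ρ}).ncard with hN
  have hcount : (p : ℂ) ^ 2 * N = ∑ y : ZMod p, ∑ z : ZMod p, e (y * -ρ) *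
      ∑ x : F, ψ (ι y * (a * x ^ 2) + ι z * x) := by
    have hx (x : F) : ∑ y : ZMod p, ∑ z : ZMod p, e (y * -ρ) *
        ψ (ι y * (a * x ^ 2) + ι z * x) =
        if x ≠ 0 ∧ T x = 0 ∧ T (a * x ^ 2) = ρ then (p : ℂ) ^ 2 else 0 := by
      have h1 (y z : ZMod p) : e (y * -ρ) * ψ (ι y * (a * x ^ 2) + ι z * x) =
          e (y * (T (a * x ^ 2) - ρ)) * e (z * T x) := by
        rw [AddChar.map_add_eq_mul, hψ, traceAddChar_algebraMap_mul, traceAddChar_algebraMap_mul,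
          ← mul_assoc, ← AddChar.map_add_eq_mul]
        congr 2
        ring
      simp_rw [h1]
      rw [← sum_mul_sum, AddChar.sum_mulShift _ he, AddChar.sum_mulShift _ he, ZMod.card]
      have hx0 : T (a * x ^ 2) = ρ → x ≠ 0 := by
        rintro h rfl
        exact hρ (by simpa using h.symm)
      by_cases h2 : T (a * x ^ 2) = ρ
      · by_cases h3 : T x = 0 <;> simp [h2, h3, hx0 h2, ← sq]
      · simp [h2, sub_eq_zero]
    have hN' : (N : ℂ) = ∑ x : F, if x ≠ 0 ∧ T x = 0 ∧ T (a * x ^ 2) = ρ then 1 else 0 := by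
      rw [hN, Set.ncard_eq_toFinset_card', Set.toFinset_ofPred, sum_boole]
    rw [hN', mul_sum]
    simp_rw [mul_ite, mul_one, mul_zero, ← hx, mul_sum]
    rw [sum_comm]
    exact sum_congr rfl fun y _ => sum_comm
  have hcount2 : (p : ℂ) ^ 2 * N = (p : ℂ) ^ (2 * (n + 1)) - p * D := by
    rw [hcount]
    simp_rw [hin, ← mul_sum]
    have h1 (y : ZMod p) : e (y * -ρ) * ∑ z : ZMod p,
        (if y = 0 then (if z = 0 then (p : ℂ) ^ (2 * (n + 1)) else 0) else D) =
        e (y * -ρ) * (p * D) + if y = 0 then (p : ℂ) ^ (2 * (n + 1)) - p * D else 0 := by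
      by_cases hy : y = 0 <;> simp [hy, ZMod.card]
    simp_rw [h1]
    rw [sum_add_distrib, ← sum_mul, AddChar.sum_mulShift _ he]
    simp [hρ]
  have hp0 : (p : ℂ) ≠ 0 := by exact_mod_cast (Fact.out : p.Prime).ne_zero
  have e1 : 2 * (n + 1) - 2 = 2 * n := by omega
  have e2 : 2 * (n + 1) / 2 = n + 1 := by omega
  have e3 : 2 * n / 2 = n := by omega
  rw [e1, e2, e3]
  have hfin : (N : ℂ) = (p : ℂ) ^ (2 * n) +
      (-1) ^ ((p - 1) / 2 * (n + 1)) * quadraticChar F a * (p : ℂ) ^ n := by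
    apply mul_left_cancel₀ (pow_ne_zero 2 hp0)
    rw [hcount2, hD, hG]
    ring
  exact_mod_cast hfin
end

section
/- Let m be odd. For every a ∈ F_r^* with Tr(a^{-1}) = 0 and every ρ ∈ F_p^*, the number N_a(ρ) of x ∈ F_r^* with Tr(x) = 0 and Tr(ax²) = ρ equals p^{m-2} + (-1)^{((p-1)/2)·((m-1)/2)} · η(a) · η̄(ρ) · p^{(m-1)/2}. -/
open Module

/-- For a Galois extension of odd degree, the Galois group acts on itself by even permutations, so
the determinant of the matrix of conjugates lies in the base field. -/
lemma exists_algebraMap_eq_det_conjugates {K L : Type*} [Field K] [Field L] [Algebra K L]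
    [FiniteDimensional K L] [IsGalois K L] [DecidableEq Gal(L/K)]
    (hodd : Odd (Nat.card Gal(L/K))) (b : Gal(L/K) → L) :
    ∃ d : K, algebraMap K L d = (Matrix.of fun i (τ : Gal(L/K)) ↦ τ (b i)).det := by
  refine (IsGalois.mem_range_algebraMap_iff_fixed _).mpr fun g ↦ ?_
  have hsign : Equiv.Perm.sign (Equiv.mulLeft g) = 1 := by
    have h : Equiv.mulLeft g ^ Nat.card Gal(L/K) = 1 := by
      ext x
      simp [Equiv.pow_mulLeft]
    have h' := congrArg Equiv.Perm.sign h
    obtain ⟨k, hk⟩ := hodd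
    rwa [map_pow, map_one, hk, pow_succ, pow_mul, Int.units_sq, one_pow, one_mul] at h'
  have h := Matrix.det_permute' (Equiv.mulLeft g) (Matrix.of fun i (τ : Gal(L/K)) ↦ τ (b i))
  rw [hsign, Units.val_one, Int.cast_one, one_mul] at h
  exact (AlgEquiv.map_det g _).trans h

/-- In odd degree, the form `(x, y) ↦ Tr (a * x * y)` of a Galois extension has an orthogonal
basis whose Gram determinant is the norm of `a` up to a square. -/
lemma exists_basis_trace_mul_orthogonal {K L : Type*} [Field K] [Field L] [Algebra K L]
    [FiniteDimensional K L] [IsGalois K L] (h2 : (2 : K) ≠ 0)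
    (hodd : Odd (finrank K L)) {a : L} (ha : a ≠ 0) :
    ∃ (b : Basis Gal(L/K) K L) (d : K),
      (∀ i j, i ≠ j → Algebra.trace K L (a * (b i * b j)) = 0) ∧
      (∀ i, Algebra.trace K L (a * (b i * b i)) ≠ 0) ∧
      ∏ i, Algebra.trace K L (a * (b i * b i)) = Algebra.norm K a * d ^ 2 := by
  classical
  have := invertibleOfNonzero h2
  let B : LinearMap.BilinForm K L := (Algebra.traceForm K L).compLeft (LinearMap.mulLeft K a)
  have hB (x y : L) : B x y = Algebra.trace K L (a * (x * y)) := by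
    simp [B, Algebra.traceForm_apply, mul_assoc]
  have hBsymm : LinearMap.IsSymm B := ⟨fun x y ↦ by simp [hB, mul_comm x y]⟩
  obtain ⟨v, hv⟩ := LinearMap.BilinForm.exists_orthogonal_basis hBsymm
  have hcard := IsGalois.card_aut_eq_finrank K L
  let e : Fin (finrank K L) ≃ Gal(L/K) := (Finite.equivFinOfCardEq hcard).symm
  let b := v.reindex e
  have horth (i j) (hij : i ≠ j) : Algebra.trace K L (a * (b i * b j)) = 0 := by
    rw [← hB]
    simpa [b] using hv (i := e.symm i) (j := e.symm j) (by simpa using hij)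
  obtain ⟨d, hd⟩ := exists_algebraMap_eq_det_conjugates (K := K) (L := L) (hcard ▸ hodd) b
  refine ⟨b, d, horth, fun i hi ↦ ?_, ?_⟩
  · have hzero : LinearMap.mulLeft K a (b i) = 0 := by
      refine (traceForm_nondegenerate K L).1 _ fun y ↦ ?_
      have : B (b i) = 0 := b.ext fun j ↦ by
        rw [hB, LinearMap.zero_apply]
        rcases eq_or_ne i j with rfl | hij
        exacts [hi, horth i j hij]
      exact LinearMap.congr_fun this y
    exact (mul_ne_zero ha (b.ne_zero i)) hzero
  · apply (algebraMap K L).injective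
    set M : Matrix Gal(L/K) Gal(L/K) L := Matrix.of fun i (τ : Gal(L/K)) ↦ τ (b i)
    have hM : M * Matrix.diagonal (fun τ : Gal(L/K) ↦ τ a) * M.transpose =
        Matrix.diagonal fun i ↦ algebraMap K L (Algebra.trace K L (a * (b i * b i))) := by
      ext i j
      have hij : (M * Matrix.diagonal (fun τ : Gal(L/K) ↦ τ a) * M.transpose) i j =
          algebraMap K L (Algebra.trace K L (a * (b i * b j))) := by
        rw [trace_eq_sum_automorphisms, Matrix.mul_apply]
        refine Finset.sum_congr rfl fun τ _ ↦ ?_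
        simp [M]
        ring
      rw [hij, Matrix.diagonal_apply]
      split_ifs with h
      · rw [h]
      · rw [horth i j h, map_zero]
    have hdet := congrArg Matrix.det hM
    rw [Matrix.det_mul, Matrix.det_mul, Matrix.det_transpose, Matrix.det_diagonal,
      Matrix.det_diagonal, ← hd, ← Algebra.norm_eq_prod_automorphisms] at hdet
    rw [map_prod, ← hdet, map_mul, map_pow]
    ring

/-- The quadratic character of an extension of finite fields factors through the norm. -/
lemma quadraticChar_norm {K L : Type*} [Field K] [Fintype K] [DecidableEq K] [Field L] [Fintype L]
    [DecidableEq L] [Algebra K L] (hK : ringChar K ≠ 2) {a : L} (ha : a ≠ 0) :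
    quadraticChar K (Algebra.norm K a) = quadraticChar L a := by
  have hL : ringChar L ≠ 2 := by rwa [← Algebra.ringChar_eq K L]
  have hn : Algebra.norm K a ≠ 0 := Algebra.norm_ne_zero_iff.mpr ha
  obtain ⟨k, hk⟩ : Fintype.card K - 1 ∣ Fintype.card L - 1 := by
    rw [Module.card_eq_pow_finrank (K := K) (V := L)]
    simpa using Nat.sub_dvd_pow_sub_pow (Fintype.card K) 1 (finrank K L)
  have hK1 := FiniteField.odd_card_of_char_ne_two hK
  have hL1 := FiniteField.odd_card_of_char_ne_two hL
  have hcK := Fintype.one_lt_card (α := K)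
  have hexp : k * (Fintype.card K / 2) = Fintype.card L / 2 := by
    obtain ⟨s, hs⟩ : ∃ s, Fintype.card K = 2 * s + 1 := ⟨Fintype.card K / 2, by omega⟩
    obtain ⟨t, ht⟩ : ∃ t, Fintype.card L = 2 * t + 1 := ⟨Fintype.card L / 2, by omega⟩
    rw [hs, ht] at hk ⊢
    have : 2 * t = 2 * s * k := by simpa using hk
    have : t = s * k := by linarith
    rw [show (2 * s + 1) / 2 = s by omega, show (2 * t + 1) / 2 = t by omega, this, mul_comm]
  have hkdiv : (Fintype.card L - 1) / (Fintype.card K - 1) = k := by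
    rw [hk, Nat.mul_div_cancel_left _ (by omega)]
  have hpow : algebraMap K L (Algebra.norm K a ^ (Fintype.card K / 2)) =
      a ^ (Fintype.card L / 2) := by
    rw [map_pow, FiniteField.algebraMap_norm_eq_pow, Nat.card_eq_fintype_card,
      Nat.card_eq_fintype_card, hkdiv, ← pow_mul, hexp]
  have hiff : Algebra.norm K a ^ (Fintype.card K / 2) = 1 ↔ a ^ (Fintype.card L / 2) = 1 := by
    rw [← hpow, map_eq_one_iff _ (algebraMap K L).injective]
  rw [quadraticChar_eq_pow_of_char_ne_two hK hn, quadraticChar_eq_pow_of_char_ne_two hL ha]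
  simp only [hiff]

lemma sum_quadraticChar_mul_addChar {K R : Type*} [Field K] [Fintype K] [DecidableEq K]
    [CommRing R] (ψ : AddChar K R) {c : K} (hc : c ≠ 0) :
    ∑ u, (quadraticChar K u : R) * ψ (c * u) =
      (quadraticChar K c : R) *
        gaussSum ((quadraticChar K).ringHomComp (Int.castRingHom R)) ψ := by
  have hshift := gaussSum_mulShift_eq ((quadraticChar K).ringHomComp (Int.castRingHom R)) ψ
    (Units.mk0 c hc)
  rwa [((quadraticChar_isQuadratic K).comp _).inv] at hshift

lemma sum_addChar_mul_trace {K L R : Type*} [Field K] [Finite K] [Field L] [Fintype L]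
    [Algebra K L] [CommRing R] [IsDomain R] {ψ : AddChar K R} (hψ : ψ.IsPrimitive) {s : K}
    (hs : s ≠ 0) :
    ∑ x : L, ψ (s * Algebra.trace K L x) = 0 := by
  obtain ⟨u, hu⟩ := (AddChar.ne_one_iff).mp (hψ hs)
  obtain ⟨y, rfl⟩ := Algebra.trace_surjective K L u
  exact AddChar.sum_eq_zero_of_ne_one (R := L)
    (ψ := (ψ.mulShift s).compAddMonoidHom (Algebra.trace K L).toAddMonoidHom)
    ((AddChar.ne_one_iff).mpr ⟨y, hu⟩)

section QuadraticGaussSum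

variable {K R : Type*} [Field K] [Fintype K] [DecidableEq K] [CommRing R] [IsDomain R]

/-- The quadratic Gauss sum as a sum over squares. -/
lemma sum_addChar_mul_sq_s2 (hK : ringChar K ≠ 2) {ψ : AddChar K R} (hψ : ψ.IsPrimitive) {c : K}
    (hc : c ≠ 0) :
    ∑ y, ψ (c * y ^ 2) =
      (quadraticChar K c : R) *
        gaussSum ((quadraticChar K).ringHomComp (Int.castRingHom R)) ψ := by
  have hfiber : ∑ y, ψ (c * y ^ 2) = ∑ u, ((quadraticChar K u : R) + 1) * ψ (c * u) := by
    rw [← Finset.sum_fiberwise' Finset.univ (fun y : K ↦ y ^ 2) fun u ↦ ψ (c * u)]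
    refine Finset.sum_congr rfl fun u _ ↦ ?_
    have h := congrArg (Int.cast : ℤ → R) (quadraticChar_card_sqrts hK u)
    rw [Finset.sum_const, nsmul_eq_mul]
    push_cast at h
    rw [← h]
    congr 3
    ext; simp
  have hzero : ∑ u, ψ (c * u) = 0 := by
    simpa [mul_comm, hc] using AddChar.sum_mulShift c hψ
  simp only [add_mul, one_mul, Finset.sum_add_distrib, hzero, add_zero, hfiber]
  exact sum_quadraticChar_mul_addChar ψ hc

/-- Quadratic Gauss sums of odd degree extensions, in terms of those of the base field. -/
lemma sum_addChar_trace_mul_sq {L : Type*} [Field L] [Fintype L] [DecidableEq L] [Algebra K L]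
    (hK : ringChar K ≠ 2) (hodd : Odd (finrank K L)) {ψ : AddChar K R} (hψ : ψ.IsPrimitive)
    {a : L} (ha : a ≠ 0) :
    ∑ x : L, ψ (Algebra.trace K L (a * x ^ 2)) =
      (quadraticChar L a : R) *
        gaussSum ((quadraticChar K).ringHomComp (Int.castRingHom R)) ψ ^ finrank K L := by
  classical
  obtain ⟨b, d, horth, hne, hprod⟩ :=
    exists_basis_trace_mul_orthogonal (Ring.two_ne_zero hK) hodd ha
  have hdiag (y : Gal(L/K) → K) : Algebra.trace K L (a * (b.equivFun.symm y) ^ 2) =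
      ∑ i, Algebra.trace K L (a * (b i * b i)) * y i ^ 2 := by
    rw [b.equivFun_symm_apply, sq, Finset.sum_mul_sum, Finset.mul_sum, map_sum]
    refine Finset.sum_congr rfl fun i _ ↦ ?_
    have hterm (j) : a * (y i • b i * y j • b j) = (y i * y j) • (a * (b i * b j)) := by
      simp only [Algebra.smul_def, map_mul]; ring
    rw [Finset.mul_sum, map_sum, Finset.sum_eq_single i]
    · rw [hterm, map_smul, smul_eq_mul]; ring
    · intro j _ hj
      rw [hterm, map_smul, horth i j hj.symm, smul_zero]
    · simp
  have hd : d ≠ 0 := by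
    rintro rfl
    rw [zero_pow two_ne_zero, mul_zero] at hprod
    exact Finset.prod_ne_zero_iff.mpr (fun i _ ↦ hne i) hprod
  rw [← b.equivFun.symm.toEquiv.sum_comp]
  have hmap (f : Gal(L/K) → K) : ψ (∑ i, f i) = ∏ i, ψ (f i) := by
    change ψ.toMonoidHom (Multiplicative.ofAdd (∑ i, f i)) = _
    rw [ofAdd_sum, map_prod]
    rfl
  simp only [LinearEquiv.coe_toEquiv, hdiag, hmap]
  rw [← Fintype.prod_sum fun i (u : K) ↦ ψ (Algebra.trace K L (a * (b i * b i)) * u ^ 2)]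
  simp only [sum_addChar_mul_sq_s2 hK hψ (hne _), Finset.prod_mul_distrib, Finset.prod_const]
  rw [Finset.card_univ, ← Nat.card_eq_fintype_card, IsGalois.card_aut_eq_finrank, ← Int.cast_prod,
    ← map_prod, hprod, map_mul, quadraticChar_sq_one' hd, mul_one, quadraticChar_norm hK ha]

/-- Completing the square: if `Tr a⁻¹ = 0`, a linear term does not change the Gauss sum. -/
lemma sum_addChar_trace_linear_add_sq {L : Type*} [Field L] [Fintype L] [DecidableEq L]
    [Algebra K L] (hK : ringChar K ≠ 2) (hodd : Odd (finrank K L)) {ψ : AddChar K R}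
    (hψ : ψ.IsPrimitive) {a : L} (ha : a ≠ 0) (hTr : Algebra.trace K L a⁻¹ = 0) (s : K) {t : K}
    (ht : t ≠ 0) :
    ∑ x : L, ψ (s * Algebra.trace K L x + t * Algebra.trace K L (a * x ^ 2)) =
      (quadraticChar L a : R) * (quadraticChar K t : R) *
        gaussSum ((quadraticChar K).ringHomComp (Int.castRingHom R)) ψ ^ finrank K L := by
  have ht' : algebraMap K L t ≠ 0 := (map_ne_zero _).mpr ht
  have h2 : (2 : K) ≠ 0 := Ring.two_ne_zero hK
  have h2' : (2 : L) ≠ 0 := by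
    rw [← map_ofNat (algebraMap K L) 2]
    exact (map_ne_zero _).mpr h2
  have hta : quadraticChar L (algebraMap K L t * a) = quadraticChar L a * quadraticChar K t := by
    rw [map_mul, ← quadraticChar_norm hK ht', Algebra.norm_algebraMap, map_pow, mul_comm]
    obtain ⟨k, hk⟩ := hodd
    rw [hk, pow_succ, pow_mul, quadraticChar_sq_one ht, one_pow, one_mul]
  rw [← Int.cast_mul, ← hta, ← sum_addChar_trace_mul_sq hK hodd hψ (mul_ne_zero ht' ha),
    ← (Equiv.subRight (algebraMap K L s / (2 * (algebraMap K L t * a)))).sum_comp]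
  refine Finset.sum_congr rfl fun x _ ↦ congrArg ψ ?_
  set y := x - algebraMap K L s / (2 * (algebraMap K L t * a)) with hy
  have hsq : s • y + t • (a * y ^ 2) =
      algebraMap K L t * a * x ^ 2 - (s ^ 2 / (4 * t)) • a⁻¹ := by
    have h4 : (4 : L) ≠ 0 := by
      rw [show (4 : L) = 2 * 2 by norm_num]
      exact mul_ne_zero h2' h2'
    simp only [hy, Algebra.smul_def, map_div₀, map_mul, map_pow, map_ofNat]
    field_simp
    ring
  change s * Algebra.trace K L y + t * Algebra.trace K L (a * y ^ 2) = _
  have htr := congrArg (Algebra.trace K L) hsq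
  simpa [hTr] using htr

/-- The number of solutions of `Tr x = 0`, `Tr (a * x ^ 2) = ρ` in odd degree, when
`Tr a⁻¹ = 0`, in terms of the quadratic Gauss sum. -/
lemma card_sq_mul_card_trace_eq {L : Type*} [Field L] [Fintype L] [DecidableEq L]
    [Algebra K L] (hK : ringChar K ≠ 2) (hodd : Odd (finrank K L)) {ψ : AddChar K R}
    (hψ : ψ.IsPrimitive) {a : L} (ha : a ≠ 0) (hTr : Algebra.trace K L a⁻¹ = 0) {ρ : K}
    (hρ : ρ ≠ 0) :
    (Fintype.card K : R) ^ 2 *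
        (Finset.univ.filter fun x : L ↦
          Algebra.trace K L x = 0 ∧ Algebra.trace K L (a * x ^ 2) = ρ).card =
      Fintype.card L + Fintype.card K * (quadraticChar L a : R) * (quadraticChar K (-ρ) : R) *
        gaussSum ((quadraticChar K).ringHomComp (Int.castRingHom R)) ψ ^ (finrank K L + 1) := by
  set g := gaussSum ((quadraticChar K).ringHomComp (Int.castRingHom R)) ψ with hg
  have hdelta (x : L) : (Fintype.card K : R) ^ 2 *
        (if Algebra.trace K L x = 0 ∧ Algebra.trace K L (a * x ^ 2) = ρ then 1 else 0) =
      ∑ t, ∑ s, ψ (-ρ * t) * ψ (s * Algebra.trace K L x + t * Algebra.trace K L (a * x ^ 2)) := by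
    have h1 := AddChar.sum_mulShift (Algebra.trace K L x) hψ
    have h2 := AddChar.sum_mulShift (Algebra.trace K L (a * x ^ 2) - ρ) hψ
    have hsplit (t s : K) :
        ψ (-ρ * t) * ψ (s * Algebra.trace K L x + t * Algebra.trace K L (a * x ^ 2)) =
          ψ (t * (Algebra.trace K L (a * x ^ 2) - ρ)) * ψ (s * Algebra.trace K L x) := by
      rw [← AddChar.map_add_eq_mul, ← AddChar.map_add_eq_mul]
      congr 1
      ring
    simp only [hsplit]
    rw [← Finset.sum_mul_sum, h1, h2]
    simp only [sub_eq_zero]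
    split_ifs <;> simp_all [sq]
  have hzero : ∑ s : K, ∑ x : L, ψ (s * Algebra.trace K L x) = Fintype.card L := by
    rw [Finset.sum_eq_single 0]
    · simp
    · exact fun s _ hs ↦ sum_addChar_mul_trace hψ hs
    · simp
  have hinner (t : K) : ∑ s : K, ∑ x : L,
      ψ (-ρ * t) * ψ (s * Algebra.trace K L x + t * Algebra.trace K L (a * x ^ 2)) =
      (if t = 0 then (Fintype.card L : R) else 0) +
        Fintype.card K * (quadraticChar L a : R) * g ^ finrank K L *
          ((quadraticChar K t : R) * ψ (-ρ * t)) := by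
    rcases eq_or_ne t 0 with rfl | ht
    · simp [hzero]
    · simp only [← Finset.mul_sum,
        sum_addChar_trace_linear_add_sq hK hodd hψ ha hTr _ ht, ← hg, if_neg ht]
      rw [Finset.sum_const, Finset.card_univ, nsmul_eq_mul]
      ring
  rw [Finset.card_filter, Nat.cast_sum, Finset.mul_sum]
  push_cast
  simp only [hdelta]
  rw [Finset.sum_comm]
  simp only [Finset.sum_comm (s := (Finset.univ : Finset L)), hinner]
  rw [Finset.sum_add_distrib, ← Finset.mul_sum,
    sum_quadraticChar_mul_addChar ψ (neg_ne_zero.mpr hρ), Finset.sum_ite_eq',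
    if_pos (Finset.mem_univ _), ← hg]
  ring

end QuadraticGaussSum

theorem stmt_2 (p m : ℕ) [Fact p.Prime] (hp2 : p ≠ 2) (hm : 2 ≤ m) (hmodd : Odd m)
    (F : Type) [Field F] [Fintype F] [DecidableEq F] [Algebra (ZMod p) F]
    (hcard : Fintype.card F = p ^ m)
    (a : F) (ha : a ≠ 0) (hTra : Algebra.trace (ZMod p) F a⁻¹ = 0)
    (ρ : ZMod p) (hρ : ρ ≠ 0) :
    (({x : F | x ≠ 0 ∧ Algebra.trace (ZMod p) F x = 0 ∧
        Algebra.trace (ZMod p) F (a * x ^ 2) = ρ}).ncard : ℤ)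
      = (p : ℤ) ^ (m - 2)
        + (-1) ^ (((p - 1) / 2) * ((m - 1) / 2)) * quadraticChar F a
          * quadraticChar (ZMod p) ρ * (p : ℤ) ^ ((m - 1) / 2) := by
  have hp : p.Prime := Fact.out
  have hK : ringChar (ZMod p) ≠ 2 := by rwa [ZMod.ringChar_zmod_n]
  have hrank : finrank (ZMod p) F = m := by
    have h := Module.card_eq_pow_finrank (K := ZMod p) (V := F)
    rw [hcard, ZMod.card] at h
    exact (Nat.pow_right_injective hp.two_le h).symm
  have hneg : quadraticChar (ZMod p) (-1) = (-1) ^ ((p - 1) / 2) := by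
    have hodd : p % 2 = 1 := hp.eq_two_or_odd.resolve_left hp2
    rw [quadraticChar_neg_one hK, ZMod.card, ZMod.χ₄_eq_neg_one_pow hodd,
      show (p - 1) / 2 = p / 2 by omega]
  have hset : {x : F | x ≠ 0 ∧ Algebra.trace (ZMod p) F x = 0 ∧
      Algebra.trace (ZMod p) F (a * x ^ 2) = ρ} =
      (Finset.univ.filter fun x : F ↦ Algebra.trace (ZMod p) F x = 0 ∧
        Algebra.trace (ZMod p) F (a * x ^ 2) = ρ : Finset F) := by
    ext x
    simp only [Set.mem_ofPred_eq, Finset.coe_filter, Finset.mem_univ, true_and,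
      and_iff_right_iff_imp]
    rintro ⟨-, h⟩ rfl
    simp [hρ.symm] at h
  rw [hset, Set.ncard_coe_finset]
  set N := (Finset.univ.filter fun x : F ↦ Algebra.trace (ZMod p) F x = 0 ∧
        Algebra.trace (ZMod p) F (a * x ^ 2) = ρ).card
  have hψ := ZMod.isPrimitive_stdAddChar p
  have hcount := card_sq_mul_card_trace_eq hK (hrank ▸ hmodd) hψ ha hTra hρ
  have hχ : (quadraticChar (ZMod p)).ringHomComp (Int.castRingHom ℂ) ≠ 1 := by
    rw [Ne, MulChar.ringHomComp_eq_one_iff Int.cast_injective]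
    exact quadraticChar_ne_one hK
  have hg := gaussSum_sq hχ ((quadraticChar_isQuadratic (ZMod p)).comp _) hψ
  obtain ⟨k, rfl⟩ := hmodd
  obtain ⟨k, rfl⟩ : ∃ j, k = j + 1 := ⟨k - 1, by omega⟩
  rw [hrank, show 2 * (k + 1) + 1 + 1 = 2 * (k + 2) by ring, pow_mul, hg,
    MulChar.ringHomComp_apply, hcard, ZMod.card, neg_eq_neg_one_mul ρ, map_mul, hneg] at hcount
  rw [show 2 * (k + 1) + 1 - 2 = 2 * k + 1 by omega,
    show (2 * (k + 1) + 1 - 1) / 2 = k + 1 by omega, pow_mul]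
  generalize hε : (-1 : ℤ) ^ ((p - 1) / 2) = ε at *
  have hε2 : ε ^ 2 = 1 := by rw [← hε, ← pow_mul, mul_comm, pow_mul, neg_one_sq, one_pow]
  have hcountZ : (p : ℤ) ^ 2 * N = p ^ (2 * (k + 1) + 1) + p * quadraticChar F a *
      (ε * quadraticChar (ZMod p) ρ) * (ε * p) ^ (k + 2) := by
    rw [eq_intCast] at hcount
    exact_mod_cast hcount
  have hp0 : (p : ℤ) ^ 2 ≠ 0 := pow_ne_zero _ (mod_cast hp.ne_zero)
  apply mul_left_cancel₀ hp0
  rw [hcountZ]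
  linear_combination (p * quadraticChar F a * quadraticChar (ZMod p) ρ * ε ^ (k + 1) *
    (p : ℤ) ^ (k + 2)) * hε2
end

section
/- Let m be odd. Then #{a ∈ F_r^* : η(a) = 1 and Tr(a^{-1}) = 0} = #{a ∈ F_r^* : η(a) = -1 and Tr(a^{-1}) = 0} = (p^{m-1} − 1)/2. -/
/-- A nonsquare stays a nonsquare in an extension of odd degree. -/
theorem not_isSquare_algebraMap_of_odd_finrank {K L : Type*} [Field K] [Field L] [Algebra K L]
    (hodd : Odd (Module.finrank K L)) {x : K} (hx : ¬ IsSquare x) :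
    ¬ IsSquare (algebraMap K L x) := by
  rintro ⟨b, hb⟩
  obtain ⟨k, hk⟩ := hodd
  have h0 : x ≠ 0 := by
    rintro rfl
    exact hx (IsSquare.zero)
  have h := Algebra.norm_algebraMap (S := L) x
  rw [hb, map_mul, hk] at h
  refine hx ⟨Algebra.norm K b / x ^ k, ?_⟩
  field_simp
  linear_combination -h

/-- The kernel of the trace of a finite separable extension has codimension one. -/
theorem finrank_ker_trace_add_one (K L : Type*) [Field K] [Field L] [Algebra K L]
    [FiniteDimensional K L] [Algebra.IsSeparable K L] :
    Module.finrank K (LinearMap.ker (Algebra.trace K L)) + 1 = Module.finrank K L := by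
  have h := LinearMap.finrank_range_add_finrank_ker (Algebra.trace K L)
  rw [LinearMap.range_eq_top.mpr (Algebra.trace_surjective K L), finrank_top,
    Module.finrank_self] at h
  omega

theorem stmt_8 (p m : ℕ) [Fact p.Prime] (hp2 : p ≠ 2) (hm : 2 ≤ m) (hmodd : Odd m)
    (F : Type) [Field F] [Fintype F] [DecidableEq F] [Algebra (ZMod p) F]
    (hcard : Fintype.card F = p ^ m) :
    ({a : F | a ≠ 0 ∧ quadraticChar F a = 1 ∧ Algebra.trace (ZMod p) F a⁻¹ = 0}).ncard
        = (p ^ (m - 1) - 1) / 2 ∧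
    ({a : F | a ≠ 0 ∧ quadraticChar F a = -1 ∧ Algebra.trace (ZMod p) F a⁻¹ = 0}).ncard
        = (p ^ (m - 1) - 1) / 2 := by
  have hp : p.Prime := Fact.out
  have hfin : Module.finrank (ZMod p) F = m := by
    have h := Module.card_eq_pow_finrank (K := ZMod p) (V := F)
    rw [ZMod.card, hcard] at h
    exact (Nat.pow_right_injective hp.two_le h).symm
  set S : ℤ → Set F := fun e ↦
    {a | a ≠ 0 ∧ quadraticChar F a = e ∧ Algebra.trace (ZMod p) F a⁻¹ = 0} with hS
  change (S 1).ncard = _ ∧ (S (-1)).ncard = _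
  obtain ⟨n, hn⟩ := FiniteField.exists_nonsquare (F := ZMod p) (by rwa [ZMod.ringChar_zmod_n])
  have hnF : quadraticChar F (algebraMap (ZMod p) F n) = -1 :=
    quadraticChar_neg_one_iff_not_isSquare.mpr
      (not_isSquare_algebraMap_of_odd_finrank (hfin ▸ hmodd) hn)
  have hn0 : algebraMap (ZMod p) F n ≠ 0 := fun h ↦ by simp [h] at hnF
  have hmaps (e : ℤ) : (S e).ncard ≤ (S (-e)).ncard := by
    refine Set.ncard_le_ncard_of_injOn (fun a ↦ algebraMap (ZMod p) F n * a) ?_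
      (mul_right_injective₀ hn0).injOn (Set.toFinite _)
    rintro a ⟨ha, hq, ht⟩
    refine ⟨mul_ne_zero hn0 ha, by rw [map_mul, hnF, hq, neg_one_mul], ?_⟩
    rw [mul_inv, ← map_inv₀, ← Algebra.smul_def, map_smul, ht, smul_zero]
  have heq : (S 1).ncard = (S (-1)).ncard :=
    (hmaps 1).antisymm (by simpa using hmaps (-1))
  have hdisj : Disjoint (S 1) (S (-1)) := by
    rw [Set.disjoint_left]
    rintro a ⟨_, h1, _⟩ ⟨_, h2, _⟩
    omega
  have hunion : S 1 ∪ S (-1) =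
      Inv.inv '' ((LinearMap.ker (Algebra.trace (ZMod p) F) : Set F) \ {0}) := by
    ext a
    rw [Set.image_inv_eq_inv, Set.mem_inv]
    simp only [hS, Set.mem_union, Set.mem_ofPred_eq, Set.mem_sdiff, SetLike.mem_coe,
      LinearMap.mem_ker, Set.mem_singleton_iff, inv_eq_zero]
    have := fun h : a ≠ 0 ↦ quadraticChar_dichotomy h
    tauto
  have hker : (LinearMap.ker (Algebra.trace (ZMod p) F) : Set F).ncard = p ^ (m - 1) := by
    have h := finrank_ker_trace_add_one (ZMod p) F
    rw [← Nat.card_coe_set_eq]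
    change Nat.card (LinearMap.ker (Algebra.trace (ZMod p) F)) = _
    rw [Module.natCard_eq_pow_finrank (K := ZMod p), Nat.card_zmod, ← hfin, ← h,
      Nat.add_sub_cancel]
  have htot := Set.ncard_union_eq hdisj
  rw [hunion, Set.ncard_image_of_injective _ inv_injective,
    Set.ncard_sdiff_singleton_of_mem (by simp), hker] at htot
  omega
end

section
/- Let m be even. Then #{a ∈ F_r^* : η(a) = 1 and η̄(Tr(a^{-1})) = 1} = #{a ∈ F_r^* : η(a) = 1 and η̄(Tr(a^{-1})) = -1} = (p−1)·(p^{m-1} + (-1)^{((p-1)/2)·(m/2)} p^{(m-2)/2})/4. -/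
section TraceFibers

variable {K L : Type*} [Field K] [Field L] [Algebra K L] [Finite L]

open Module

theorem FiniteField.isSquare_algebraMap_of_even_finrank (h : Even (finrank K L)) (x : K) :
    IsSquare (algebraMap K L x) := by
  classical
  have : Finite K := Finite.of_injective _ (algebraMap K L).injective
  have := Fintype.ofFinite K
  have := Fintype.ofFinite L
  by_cases h2 : ringChar L = 2
  · exact FiniteField.isSquare_of_char_two h2 _
  rcases eq_or_ne x 0 with rfl | hx
  · simp
  rw [FiniteField.isSquare_iff h2 (by simpa using hx), ← map_pow]
  have hodd : Fintype.card K % 2 = 1 := FiniteField.odd_card_of_char_ne_two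
    (by rwa [Algebra.ringChar_eq K L])
  obtain ⟨n, hn⟩ := h
  have hcard : Fintype.card L = (Fintype.card K ^ n) * (Fintype.card K ^ n) := by
    rw [Module.card_eq_pow_finrank (K := K) (V := L), hn, pow_add]
  obtain ⟨c, hc⟩ : Fintype.card K - 1 ∣ Fintype.card K ^ n - 1 := Nat.sub_one_dvd_pow_sub_one _ n
  obtain ⟨d, hd⟩ : Odd (Fintype.card K ^ n) := (Nat.odd_iff.2 hodd).pow
  have : Fintype.card L / 2 = (Fintype.card K - 1) * (c * (d + 1)) := by
    rw [← mul_assoc, ← hc, hcard, hd]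
    simp only [Nat.add_sub_cancel]
    have : (2 * d + 1) * (2 * d + 1) = 2 * (2 * d * (d + 1)) + 1 := by ring
    omega
  rw [this, pow_mul, FiniteField.pow_card_sub_one_eq_one x hx, one_pow, map_one]

theorem FiniteField.card_mul_card_trace_fiber (t : K) :
    Nat.card K * Nat.card {b : L // Algebra.trace K L b = t} = Nat.card L := by
  have : Finite K := Finite.of_injective _ (algebraMap K L).injective
  have := Fintype.ofFinite K
  have hs := Algebra.trace_surjective K L
  rw [Nat.card_congr (Equiv.sigmaFiberEquiv (Algebra.trace K L)).symm, Nat.card_sigma,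
    Finset.sum_congr rfl fun s _ ↦ ?_, Finset.sum_const, Finset.card_univ, smul_eq_mul,
    Nat.card_eq_fintype_card]
  obtain ⟨c, hc⟩ := hs (t - s)
  exact Nat.card_congr ((Equiv.addRight c).subtypeEquiv fun b ↦ by
    simp [hc, ← eq_sub_iff_add_eq])

/-- The Sylow 2-subgroup of `Gal(L/K)` acts on the squares of trace `t`; its fixed points are
the elements of trace `t` in a subfield of odd degree. -/
theorem FiniteField.odd_card_isSquare_trace_eq (h2 : ringChar K ≠ 2) (h : Even (finrank K L))
    (t : K) : Odd (Nat.card {b : L // IsSquare b ∧ Algebra.trace K L b = t}) := by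
  have : Finite K := Finite.of_injective _ (algebraMap K L).injective
  let P : Sylow 2 Gal(L/K) := default
  let A : SubMulAction P L :=
    { carrier := {b | IsSquare b ∧ Algebra.trace K L b = t}
      smul_mem' := fun g b hb ↦ ⟨hb.1.map (g : Gal(L/K)), by
        rw [← hb.2]
        exact Algebra.trace_eq_of_algEquiv (g : Gal(L/K)) b⟩ }
  let E := IntermediateField.fixedField (P : Subgroup Gal(L/K))
  have hE : finrank E L = Nat.card P := IntermediateField.finrank_fixedField_eq_card _
  obtain ⟨k, hk⟩ := P.isPGroup'.exists_card_eq
  have hk0 : k ≠ 0 := by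
    rintro rfl
    have hdvd : ¬ 2 ∣ (P : Subgroup Gal(L/K)).index := P.not_dvd_index
    have := (P : Subgroup Gal(L/K)).card_mul_index
    rw [IsGalois.card_aut_eq_finrank] at this
    rw [hk, pow_zero, one_mul] at this
    exact hdvd (this ▸ h.two_dvd)
  have hEeven : Even (finrank E L) := by
    rw [hE, hk]; exact even_two.pow_of_ne_zero hk0
  have hne : ((finrank E L : ℕ) : K) ≠ 0 := by
    rw [hE, hk]; push_cast
    exact pow_ne_zero _ (Ring.two_ne_zero h2)
  have htr (x : E) : Algebra.trace K L (x : L) = (finrank E L : K) * Algebra.trace K E x := by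
    rw [← Algebra.trace_trace (S := E) (x : L)]
    have : Algebra.trace E L (x : L) = finrank E L • x := Algebra.trace_algebraMap (S := L) x
    rw [this, map_nsmul, nsmul_eq_mul]
  have hfix : Nat.card (MulAction.fixedPoints P A) =
      Nat.card {x : E // Algebra.trace K E x = (finrank E L : K)⁻¹ * t} := by
    refine Nat.card_congr
      { toFun := fun b ↦ ⟨⟨b.1.1, fun g ↦ congrArg Subtype.val (b.2 g)⟩, ?_⟩
        invFun := fun x ↦ ⟨⟨x.1.1, isSquare_algebraMap_of_even_finrank hEeven x.1, ?_⟩,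
          fun g ↦ Subtype.ext (x.1.2 g)⟩
        left_inv := fun b ↦ rfl
        right_inv := fun x ↦ rfl }
    · rw [eq_inv_mul_iff_mul_eq₀ hne, ← htr]
      exact b.1.2.2
    · rw [htr, x.2, mul_inv_cancel_left₀ hne]
  have hmod := P.isPGroup'.card_modEq_card_fixedPoints A
  rw [hfix] at hmod
  have hEodd : Odd (Nat.card E) := by
    have := Fintype.ofFinite E
    rw [Nat.card_eq_fintype_card, Nat.odd_iff]
    exact FiniteField.odd_card_of_char_ne_two (by rwa [← Algebra.ringChar_eq K E])
  rw [← card_mul_card_trace_fiber (K := K) ((finrank E L : K)⁻¹ * t)] at hEodd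
  have := (Nat.odd_mul.1 hEodd).2
  rw [Nat.odd_iff] at this ⊢
  exact (show _ % 2 = _ % 2 from hmod).trans this

end TraceFibers

section Gauss

open Finset Module

variable {p : ℕ} [Fact p.Prime] {F : Type*} [Field F] [Fintype F] [DecidableEq F]
  [Algebra (ZMod p) F]

theorem quadraticChar_smul_of_even_finrank (h : Even (finrank (ZMod p) F)) {t : ZMod p}
    (ht : t ≠ 0) (b : F) : quadraticChar F (t • b) = quadraticChar F b := by
  rw [Algebra.smul_def, map_mul, (quadraticChar_one_iff_isSquare (by simpa using ht)).2
    (FiniteField.isSquare_algebraMap_of_even_finrank h t), one_mul]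

theorem sum_quadraticChar_trace_eq (h : Even (finrank (ZMod p) F)) {t : ZMod p} (ht : t ≠ 0) :
    ∑ b : F with Algebra.trace (ZMod p) F b = t, quadraticChar F b =
      ∑ b : F with Algebra.trace (ZMod p) F b = 1, quadraticChar F b := by
  refine Finset.sum_bij' (fun b _ ↦ t⁻¹ • b) (fun b _ ↦ t • b) ?_ ?_ ?_ ?_ ?_ <;>
    simp +contextual [-quadraticChar_apply, ht, quadraticChar_smul_of_even_finrank h]

theorem card_quadraticChar_trace_eq (h : Even (finrank (ZMod p) F)) {t : ZMod p} (ht : t ≠ 0) :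
    #{b : F | quadraticChar F b = 1 ∧ Algebra.trace (ZMod p) F b = t} =
      #{b : F | quadraticChar F b = 1 ∧ Algebra.trace (ZMod p) F b = 1} := by
  refine Finset.card_bij' (fun b _ ↦ t⁻¹ • b) (fun b _ ↦ t • b) ?_ ?_ ?_ ?_ <;>
    simp +contextual [-quadraticChar_apply, ht, quadraticChar_smul_of_even_finrank h]

/-- The quadratic Gauss sum of `F` equals `-p` times the sum of the quadratic character over the
trace one hyperplane. -/
theorem sq_mul_sq_sum_quadraticChar_trace_eq_one (hp2 : p ≠ 2) (h : Even (finrank (ZMod p) F)) :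
    (p : ℤ) ^ 2 * (∑ b : F with Algebra.trace (ZMod p) F b = 1, quadraticChar F b) ^ 2 =
      Fintype.card F := by
  set T := ∑ b : F with Algebra.trace (ZMod p) F b = 1, quadraticChar F b with hT
  have hchar : ringChar F ≠ 2 := by
    rwa [← Algebra.ringChar_eq (ZMod p) F, ZMod.ringChar_zmod_n]
  set S : ZMod p → ℤ := fun t ↦ ∑ b : F with Algebra.trace (ZMod p) F b = t, quadraticChar F b
    with hS
  obtain ⟨c, hc⟩ : ∃ c, ∀ t, S t = T + if t = 0 then c else 0 := by
    refine ⟨S 0 - T, fun t ↦ ?_⟩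
    split_ifs with ht
    · simp [ht]
    · rw [add_zero]
      exact sum_quadraticChar_trace_eq h ht
  have hsum : ∑ t, S t = 0 := by
    rw [← quadraticChar_sum_zero hchar]
    exact Finset.sum_fiberwise _ _ _
  have hc' : c = -(p * T) := by
    simp_rw [hc, Finset.sum_add_distrib] at hsum
    simp [ZMod.card] at hsum
    linarith
  let ψ : AddChar F ℂ :=
    (ZMod.stdAddChar (N := p)).compAddMonoidHom (Algebra.trace (ZMod p) F).toAddMonoidHom
  have hstd : (ZMod.stdAddChar (N := p)) ≠ 1 := fun H ↦ by
    have := ZMod.isPrimitive_stdAddChar p (one_ne_zero)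
    rw [H] at this
    exact this (by ext; simp)
  have hψ : ψ.IsPrimitive := by
    refine AddChar.IsPrimitive.of_ne_one fun H ↦ hstd ?_
    ext t
    obtain ⟨b, rfl⟩ := Algebra.trace_surjective (ZMod p) F t
    exact DFunLike.congr_fun H b
  let χ := (quadraticChar F).ringHomComp (Int.castRingHom ℂ)
  have hχ1 : χ ≠ 1 := (MulChar.ringHomComp_ne_one_iff (RingHom.injective_int _)).2
    (quadraticChar_ne_one hchar)
  have hχ2 : χ.IsQuadratic := (quadraticChar_isQuadratic F).comp _
  have hgauss : gaussSum χ ψ = -(p * T : ℤ) := by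
    calc gaussSum χ ψ = ∑ t : ZMod p, (S t : ℂ) * ZMod.stdAddChar t := by
          rw [gaussSum, ← Finset.sum_fiberwise _ (Algebra.trace (ZMod p) F)]
          refine Finset.sum_congr rfl fun t _ ↦ ?_
          rw [hS]; push_cast; rw [Finset.sum_mul]
          refine Finset.sum_congr rfl fun b hb ↦ ?_
          simp only [mem_filter, mem_univ, true_and] at hb
          simp [χ, ψ, hb]
      _ = _ := by
          simp_rw [hc, hc']
          push_cast
          simp_rw [add_mul, Finset.sum_add_distrib, ← Finset.mul_sum,
            AddChar.sum_eq_zero_of_ne_one hstd]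
          simp
  have hneg : χ (-1) = 1 := by
    have : quadraticChar F (-1) = 1 := by
      have := quadraticChar_smul_of_even_finrank (F := F) h (t := (-1 : ZMod p)) (by simp) 1
      simpa using this
    simp [χ, this]
  have hsq := gaussSum_sq hχ1 hχ2 hψ
  rw [hgauss, hneg, one_mul] at hsq
  have : ((-(p * T : ℤ)) ^ 2 : ℤ) = (Fintype.card F : ℤ) := by exact_mod_cast hsq
  rw [← this]; ring

theorem two_mul_card_quadraticChar_trace_eq_one :
    2 * (#{b : F | quadraticChar F b = 1 ∧ Algebra.trace (ZMod p) F b = 1} : ℤ) =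
      ∑ b : F with Algebra.trace (ZMod p) F b = 1, quadraticChar F b +
        #{b : F | Algebra.trace (ZMod p) F b = 1} := by
  rw [← Finset.filter_filter, Finset.filter_comm, Finset.card_filter, Finset.card_eq_sum_ones]
  push_cast
  rw [← Finset.sum_add_distrib, Finset.mul_sum]
  refine Finset.sum_congr rfl fun b hb ↦ ?_
  have hb0 : b ≠ 0 := by
    rintro rfl
    simp at hb
  rcases quadraticChar_dichotomy hb0 with h | h <;> rw [h] <;> norm_num

theorem card_quadraticChar_eq_one_trace (h : Even (finrank (ZMod p) F)) {s : ℤ} (hs : s ≠ 0) :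
    #{b : F | quadraticChar F b = 1 ∧
        quadraticChar (ZMod p) (Algebra.trace (ZMod p) F b) = s} =
      #{t : ZMod p | quadraticChar (ZMod p) t = s} *
        #{b : F | quadraticChar F b = 1 ∧ Algebra.trace (ZMod p) F b = 1} := by
  rw [Finset.card_eq_sum_card_fiberwise (f := Algebra.trace (ZMod p) F)
    (t := {t : ZMod p | quadraticChar (ZMod p) t = s}) fun b hb ↦ by
      simp only [coe_filter, mem_univ, true_and, Set.mem_ofPred_eq] at hb ⊢; exact hb.2]
  refine Finset.sum_const_nat fun t ht ↦ ?_
  simp only [mem_filter, mem_univ, true_and] at ht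
  have ht0 : t ≠ 0 := by
    rintro rfl
    exact hs (ht.symm.trans quadraticChar_zero)
  rw [← card_quadraticChar_trace_eq h ht0, Finset.filter_filter]
  congr 1
  ext b
  simp only [mem_filter, mem_univ, true_and]
  constructor
  · exact fun H ↦ ⟨H.1.1, H.2⟩
  · exact fun H ↦ ⟨⟨H.1, H.2 ▸ ht⟩, H.2⟩

end Gauss

theorem two_mul_card_quadraticChar_eq {K : Type*} [Field K] [Fintype K] [DecidableEq K]
    (hK : ringChar K ≠ 2) {s : ℤ} (hs : s = 1 ∨ s = -1) :
    2 * (Finset.card {x : K | quadraticChar K x = s} : ℤ) = Fintype.card K - 1 := by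
  have key (x : K) : 2 * (if quadraticChar K x = s then 1 else 0 : ℤ) =
      1 - (if x = 0 then 1 else 0) + s * quadraticChar K x := by
    rcases eq_or_ne x 0 with rfl | hx
    · rcases hs with rfl | rfl <;> simp
    · rcases quadraticChar_dichotomy hx with h | h <;> rcases hs with rfl | rfl <;>
        simp only [h, hx] <;> norm_num
  rw [Finset.card_filter]
  push_cast
  rw [Finset.mul_sum, Finset.sum_congr rfl fun x _ ↦ key x, Finset.sum_add_distrib,
    ← Finset.mul_sum, quadraticChar_sum_zero hK]
  simp

theorem eq_neg_one_pow_mul_pow_of_sq_eq {p n : ℕ} (hp : Odd p) {T A : ℤ} (hA : Odd A)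
    (hT : T ^ 2 = (p : ℤ) ^ (2 * n)) (hAT : 2 * A = T + (p : ℤ) ^ (2 * n + 1)) :
    T = (-1) ^ ((p - 1) / 2 * (n + 1)) * (p : ℤ) ^ n := by
  obtain ⟨u, hu, hu'⟩ : ∃ u : ℤ, u = (-1) ^ ((p - 1) / 2) ∧ (p : ℤ) ≡ u [ZMOD 4] := by
    refine ⟨_, rfl, ?_⟩
    obtain ⟨k, rfl⟩ := hp
    rw [Nat.add_sub_cancel, Nat.mul_div_cancel_left _ two_pos]
    rcases Nat.even_or_odd k with hk | hk
    · rw [hk.neg_one_pow, Int.modEq_iff_dvd]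
      obtain ⟨j, rfl⟩ := hk
      exact ⟨-j, by push_cast; ring⟩
    · rw [hk.neg_one_pow, Int.modEq_iff_dvd]
      obtain ⟨j, rfl⟩ := hk
      exact ⟨-j - 1, by push_cast; ring⟩
  have hu1 : u = 1 ∨ u = -1 := hu ▸ neg_one_pow_eq_or ℤ _
  have hu2 : u ^ 2 = 1 := by rcases hu1 with rfl | rfl <;> rfl
  have hpow (k : ℕ) : u ^ (2 * k + 1) = u := by rw [pow_succ, pow_mul, hu2, one_pow, one_mul]
  rw [pow_mul, ← hu]
  have hodd : (p : ℤ) ^ (2 * n + 1) ≡ u [ZMOD 4] := hpow n ▸ hu'.pow _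
  have hmain : u ^ (n + 1) * (p : ℤ) ^ n ≡ u [ZMOD 4] := by
    have := (hu'.pow n).mul_left (u ^ (n + 1))
    rwa [← pow_add, show n + 1 + n = 2 * n + 1 by ring, hpow] at this
  have hsq : T ^ 2 = (u ^ (n + 1) * (p : ℤ) ^ n) ^ 2 := by
    rw [hT, mul_pow, pow_right_comm u, hu2, one_pow, one_mul, ← pow_mul, mul_comm]
  rcases sq_eq_sq_iff_eq_or_eq_neg.1 hsq with h | h
  · exact h
  · obtain ⟨a, rfl⟩ := hA
    rw [Int.ModEq] at hodd hmain
    omega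

theorem stmt_10 (p m : ℕ) [Fact p.Prime] (hp2 : p ≠ 2) (hm : 2 ≤ m) (hmeven : Even m)
    (F : Type) [Field F] [Fintype F] [DecidableEq F] [Algebra (ZMod p) F]
    (hcard : Fintype.card F = p ^ m) :
    ({a : F | a ≠ 0 ∧ quadraticChar F a = 1 ∧
        quadraticChar (ZMod p) (Algebra.trace (ZMod p) F a⁻¹) = 1}).ncard
      = ({a : F | a ≠ 0 ∧ quadraticChar F a = 1 ∧
        quadraticChar (ZMod p) (Algebra.trace (ZMod p) F a⁻¹) = -1}).ncard ∧
    4 * (({a : F | a ≠ 0 ∧ quadraticChar F a = 1 ∧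
        quadraticChar (ZMod p) (Algebra.trace (ZMod p) F a⁻¹) = 1}).ncard : ℤ)
      = ((p : ℤ) - 1) * ((p : ℤ) ^ (m - 1)
          + (-1) ^ (((p - 1) / 2) * (m / 2)) * (p : ℤ) ^ ((m - 2) / 2)) := by
  have hcharp : ringChar (ZMod p) ≠ 2 := by rwa [ZMod.ringChar_zmod_n]
  have hp := Fact.out (p := p.Prime)
  have hpodd : Odd p := hp.odd_of_ne_two hp2
  have hrank : Module.finrank (ZMod p) F = m := by
    have := Module.card_eq_pow_finrank (K := ZMod p) (V := F)
    rw [hcard, ZMod.card] at this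
    exact (Nat.pow_right_injective hp.two_le this).symm
  have h : Even (Module.finrank (ZMod p) F) := hrank ▸ hmeven
  set A := Finset.card {b : F | quadraticChar F b = 1 ∧ Algebra.trace (ZMod p) F b = 1} with hA
  have hcount (s : ℤ) (hs : s ≠ 0) : ({a : F | a ≠ 0 ∧ quadraticChar F a = 1 ∧
      quadraticChar (ZMod p) (Algebra.trace (ZMod p) F a⁻¹) = s}).ncard =
      Finset.card {t : ZMod p | quadraticChar (ZMod p) t = s} * A := by
    rw [hA, ← card_quadraticChar_eq_one_trace h hs, ← Set.ncard_coe_finset]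
    refine Set.ncard_congr (fun a _ ↦ a⁻¹) ?_ (fun a b _ _ ↦ inv_injective.eq_iff.1) ?_
    · rintro a ⟨-, ha, hs⟩
      simpa [-quadraticChar_apply, ← MulChar.inv_apply', (quadraticChar_isQuadratic F).inv]
        using And.intro ha hs
    · intro b hb
      simp only [Finset.coe_filter, Finset.mem_univ, true_and, Set.mem_ofPred_eq] at hb
      refine ⟨b⁻¹, ⟨?_, ?_, ?_⟩, inv_inv b⟩
      · rw [Ne, inv_eq_zero]
        rintro rfl
        simp at hb
      · rw [← MulChar.inv_apply', (quadraticChar_isQuadratic F).inv, hb.1]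
      · rw [inv_inv, hb.2]
  rw [hcount 1 one_ne_zero, hcount (-1) (by simp)]
  have hpos := two_mul_card_quadraticChar_eq hcharp (Or.inl rfl)
  have hneg := two_mul_card_quadraticChar_eq hcharp (Or.inr rfl)
  rw [ZMod.card] at hpos hneg
  refine ⟨congrArg (· * A) (by omega), ?_⟩
  obtain ⟨n, rfl⟩ : ∃ n, m = 2 * n + 2 := by
    obtain ⟨k, rfl⟩ := hmeven
    exact ⟨k - 1, by omega⟩
  have hp0 : (p : ℤ) ≠ 0 := by exact_mod_cast hp.ne_zero
  have hAodd : Odd (A : ℤ) := by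
    have := FiniteField.odd_card_isSquare_trace_eq (L := F) hcharp h 1
    rw [Nat.card_eq_fintype_card, Fintype.card_subtype] at this
    rw [Int.odd_coe_nat, hA]
    convert this using 3 with b
    refine and_congr_left fun hb ↦ quadraticChar_one_iff_isSquare (F := F) ?_
    rintro rfl
    simp at hb
  have hfib : Finset.card {b : F | Algebra.trace (ZMod p) F b = 1} = p ^ (2 * n + 1) := by
    have := FiniteField.card_mul_card_trace_fiber (K := ZMod p) (L := F) 1
    rw [Nat.card_eq_fintype_card, Nat.card_eq_fintype_card, Nat.card_eq_fintype_card,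
      Fintype.card_subtype, ZMod.card, hcard, pow_succ' p (2 * n + 1)] at this
    exact Nat.eq_of_mul_eq_mul_left hp.pos this
  have h2A := two_mul_card_quadraticChar_trace_eq_one (p := p) (F := F)
  have hsq := sq_mul_sq_sum_quadraticChar_trace_eq_one hp2 h
  rw [hfib, ← hA] at h2A
  push_cast at h2A
  rw [hcard] at hsq
  push_cast at hsq
  rw [pow_add, mul_comm ((p : ℤ) ^ (2 * n))] at hsq
  have hT := eq_neg_one_pow_mul_pow_of_sq_eq hpodd hAodd
    (mul_left_cancel₀ (pow_ne_zero 2 hp0) hsq) h2A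
  rw [show 2 * n + 2 - 1 = 2 * n + 1 by omega, show (2 * n + 2) / 2 = n + 1 by omega,
    show (2 * n + 2 - 2) / 2 = n by omega, ← hT, add_comm, ← h2A, ← hpos]
  push_cast
  ring
end
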